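/- Let n ≥ 1, ν > 0, D_X ≥ 0, let u be a standard Gaussian random vector with law N(0, I_n) on ℝ^n, let ξ be a random element independent of u, and let F(·, ξ) : ℝ^n → ℝ be a jointly measurable random function such that for every x ∈ ℝ^n: F(·, ξ) is M-Lipschitz almost surely, F(·, ξ) has an L-Lipschitz gradient almost surely, E[∇F(x, ξ)] = ∇f(x), and E[‖∇F(x, ξ) − ∇f(x)‖²] ≤ σ². Let G_ν(x, ξ, u) = ((F(x + ν u, ξ) − F(x, ξ))/ν) · u be the zeroth-order gradient estimator and let B̃ = (ν/2) L (n+3)^{3/2} + L D_X + M. Then for every x ∈ ℝ^n, E[ ‖ G_ν(x, ξ, u) ‖² ] ≤ (ν²/2) L² (n+6)³ + 4 (n+4) ( σ² + B̃² ). -/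

import Mathlib

open MeasureTheory ProbabilityTheory Real Finset
open scoped RealInnerProductSpace

noncomputable section

/-- `u` is a standard Gaussian random vector with law `N(0, I_n)` on `ℝⁿ`. -/
def IsStdGaussian {Ω : Type*} [MeasurableSpace Ω] (P : Measure Ω) {n : ℕ}
    (u : Ω → EuclideanSpace ℝ (Fin n)) : Prop :=
  Measure.map (fun ω => (fun i => u ω i)) P = Measure.pi fun _ : Fin n => gaussianReal 0 1

theorem iteratedDeriv_exp_sq_div_two {p : ℕ → Polynomial ℝ} (h0 : p 0 = 1)
    (hs : ∀ k, p (k + 1) = Polynomial.derivative (p k) + Polynomial.X * p k) (k : ℕ) :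
    iteratedDeriv k (fun t : ℝ => rexp (t ^ 2 / 2)) = fun t =>
      (p k).eval t * rexp (t ^ 2 / 2) := by
  induction k with
  | zero => ext t; simp [h0]
  | succ k ih =>
    rw [iteratedDeriv_succ, ih]
    ext t
    have h : HasDerivAt (fun t : ℝ => rexp (t ^ 2 / 2)) (rexp (t ^ 2 / 2) * t) t := by
      have := ((hasDerivAt_pow 2 t).div_const 2).exp
      simpa using this
    rw [(((p k).hasDerivAt t).fun_mul h).deriv, hs]
    simp only [Polynomial.eval_add, Polynomial.eval_mul, Polynomial.eval_X]
    ring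

theorem gaussianReal_moments :
    ∫ x, x ∂gaussianReal 0 1 = 0 ∧ ∫ x, x ^ 2 ∂gaussianReal 0 1 = 1 ∧
    ∫ x, x ^ 3 ∂gaussianReal 0 1 = 0 ∧ ∫ x, x ^ 4 ∂gaussianReal 0 1 = 3 ∧
    ∫ x, x ^ 6 ∂gaussianReal 0 1 = 15 := by
  obtain ⟨p, h0, hs⟩ : ∃ p : ℕ → Polynomial ℝ, p 0 = 1 ∧
      ∀ k, p (k + 1) = Polynomial.derivative (p k) + Polynomial.X * p k :=
    ⟨fun k => (fun q => Polynomial.derivative q + Polynomial.X * q)^[k] 1, rfl,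
      fun k => Function.iterate_succ_apply' _ _ _⟩
  have hm (k : ℕ) : ∫ x, x ^ k ∂gaussianReal 0 1 = (p k).eval 0 := by
    have h := iteratedDeriv_mgf_zero (X := fun x : ℝ => x) (μ := gaussianReal 0 1) (by simp) k
    rw [mgf_fun_id_gaussianReal] at h
    simp only [zero_mul, zero_add, NNReal.coe_one, one_mul,
      iteratedDeriv_exp_sq_div_two h0 hs] at h
    simpa using h.symm
  refine ⟨by simp, ?_, ?_, ?_, ?_⟩ <;> rw [hm] <;> simp [h0, hs] <;> norm_num

/-- A random variable with finite moments of all orders. -/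
def HasAllMoments {Ω : Type*} [MeasurableSpace Ω] (P : Measure Ω) (X : Ω → ℝ) : Prop :=
  ∀ p : ENNReal, p ≠ ⊤ → MemLp X p P

namespace HasAllMoments
variable {Ω : Type*} [MeasurableSpace Ω] {P : Measure Ω} {X Y : Ω → ℝ}

theorem mul (hX : HasAllMoments P X) (hY : HasAllMoments P Y) :
    HasAllMoments P (fun ω => X ω * Y ω) := fun p hp => by
  have : ENNReal.HolderTriple (2 * p) (2 * p) p := ⟨by
    rw [ENNReal.mul_inv (by simp) (by simp), ← add_mul, ENNReal.inv_two_add_inv_two, one_mul]⟩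
  exact (hY (2 * p) (ENNReal.mul_ne_top (by simp) hp)).mul
    (hX (2 * p) (ENNReal.mul_ne_top (by simp) hp))

theorem const [IsFiniteMeasure P] (c : ℝ) : HasAllMoments P (fun _ => c) :=
  fun _ _ => memLp_const c

theorem pow [IsFiniteMeasure P] (hX : HasAllMoments P X) (k : ℕ) :
    HasAllMoments P (fun ω => X ω ^ k) := by
  induction k with
  | zero => simpa using const 1
  | succ k ih => simpa only [pow_succ] using ih.mul hX

theorem sum [IsFiniteMeasure P] {ι : Type*} (s : Finset ι) {X : ι → Ω → ℝ}
    (hX : ∀ i, HasAllMoments P (X i)) : HasAllMoments P (fun ω => ∑ i ∈ s, X i ω) :=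
  fun p hp => memLp_finsetSum s fun i _ => hX i p hp

theorem integrable (hX : HasAllMoments P X) : Integrable X P :=
  memLp_one_iff_integrable.1 (hX 1 (by simp))

end HasAllMoments

section
variable {n : ℕ}

theorem hasAllMoments_eval_pi_gaussianReal (i : Fin n) :
    HasAllMoments (Measure.pi fun _ : Fin n => gaussianReal 0 1) (fun x => x i) := fun p hp =>
  (memLp_id_gaussianReal' p hp).comp_measurePreserving (measurePreserving_eval _ i)

theorem pi_gaussian_moments (g : Fin n → ℝ) (s : Finset (Fin n)) :
    let γ := Measure.pi fun _ : Fin n => gaussianReal 0 1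
    ∫ x, (∑ i ∈ s, g i * x i) ^ 2 ∂γ = ∑ i ∈ s, g i ^ 2 ∧
    ∫ x, (∑ i ∈ s, x i ^ 2) ∂γ = #s ∧
    ∫ x, (∑ i ∈ s, x i ^ 2) ^ 2 ∂γ = #s * (#s + 2) ∧
    ∫ x, (∑ i ∈ s, x i ^ 2) ^ 3 ∂γ = #s * (#s + 2) * (#s + 4) ∧
    ∫ x, (∑ i ∈ s, g i * x i) ^ 2 * ∑ i ∈ s, x i ^ 2 ∂γ = (#s + 2) * ∑ i ∈ s, g i ^ 2 := by
  intro γ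
  have hx (i) : HasAllMoments γ (fun x => x i) :=
    hasAllMoments_eval_pi_gaussianReal i
  have hmom (i) (k : ℕ) : ∫ x, x i ^ k ∂γ = ∫ y, y ^ k ∂gaussianReal 0 1 :=
    integral_comp_eval (μ := fun _ : Fin n => gaussianReal 0 1) (f := fun y : ℝ => y ^ k)
      (by fun_prop)
  have hindep : iIndepFun (fun i (x : Fin n → ℝ) => x i) γ :=
    iIndepFun_pi (X := fun _ => id) (fun _ => aemeasurable_id)
  obtain ⟨m1, m2, m3, m4, m6⟩ := gaussianReal_moments
  induction s using Finset.induction_on with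
  | empty => simp
  | insert a s ha ih =>
    obtain ⟨ih1, ih2, ih3, ih4, ih5⟩ := ih
    simp only [Finset.sum_insert ha, Finset.card_insert_of_notMem ha]
    push_cast
    have hi : IndepFun (fun x => (∑ i ∈ s, g i * x i, ∑ i ∈ s, x i ^ 2)) (fun x => x a) γ := by
      refine (hindep.indepFun_finset s {a} (by simpa using ha) (by fun_prop)).comp
        (φ := fun y : s → ℝ => (∑ i : s, g i * y i, ∑ i : s, y i ^ 2))
        (ψ := fun y : ({a} : Finset (Fin n)) → ℝ => y ⟨a, by simp⟩)
        (by fun_prop) (by fun_prop) |>.congr ?_ ?_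
      · filter_upwards with x
        exact Prod.ext (Finset.sum_coe_sort s fun i => g i * x i)
          (Finset.sum_coe_sort s fun i => x i ^ 2)
      · rfl
    set A : (Fin n → ℝ) → ℝ := fun x => ∑ i ∈ s, g i * x i with hA
    set S : (Fin n → ℝ) → ℝ := fun x => ∑ i ∈ s, x i ^ 2 with hS
    replace ih1 : ∫ x, A x ^ 2 ∂γ = ∑ i ∈ s, g i ^ 2 := ih1
    replace ih3 : ∫ x, S x ^ 2 ∂γ = #s * (#s + 2) := ih3
    replace ih4 : ∫ x, S x ^ 3 ∂γ = #s * (#s + 2) * (#s + 4) := ih4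
    replace ih5 : ∫ x, A x ^ 2 * S x ∂γ = (#s + 2) * ∑ i ∈ s, g i ^ 2 := ih5
    have hAm : HasAllMoments γ A := .sum s fun i => (HasAllMoments.const (g i)).mul (hx i)
    have hSm : HasAllMoments γ S := .sum s fun i => (hx i).pow 2
    have key (i j k : ℕ) : ∫ x, A x ^ i * S x ^ j * x a ^ k ∂γ =
        (∫ x, A x ^ i * S x ^ j ∂γ) * ∫ y, y ^ k ∂gaussianReal 0 1 := by
      rw [← hmom a k]
      exact (hi.comp (φ := fun p : ℝ × ℝ => p.1 ^ i * p.2 ^ j) (ψ := fun y => y ^ k)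
        (by fun_prop) (by fun_prop)).integral_fun_mul_eq_mul_integral
        ((hAm.pow i).mul (hSm.pow j)).integrable.aestronglyMeasurable
        ((hx a).pow k).integrable.aestronglyMeasurable
    have hint (c : ℝ) (i j k : ℕ) : Integrable (fun x => c * (A x ^ i * S x ^ j * x a ^ k)) γ :=
      ((HasAllMoments.const c).mul (((hAm.pow i).mul (hSm.pow j)).mul ((hx a).pow k))).integrable
    have hmono (c : ℝ) (i j k : ℕ) : ∫ x, c * (A x ^ i * S x ^ j * x a ^ k) ∂γ =
        c * ((∫ x, A x ^ i * S x ^ j ∂γ) * ∫ y, y ^ k ∂gaussianReal 0 1) := by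
      rw [integral_const_mul, key]
    have hsum (l : List (ℝ × ℕ × ℕ × ℕ)) :
        Integrable (fun x => (l.map fun q =>
          q.1 * (A x ^ q.2.1 * S x ^ q.2.2.1 * x a ^ q.2.2.2)).sum) γ ∧
        ∫ x, (l.map fun q => q.1 * (A x ^ q.2.1 * S x ^ q.2.2.1 * x a ^ q.2.2.2)).sum ∂γ =
          (l.map fun q => q.1 * ((∫ x, A x ^ q.2.1 * S x ^ q.2.2.1 ∂γ) *
            ∫ y, y ^ q.2.2.2 ∂gaussianReal 0 1)).sum := by
      induction l with
      | nil => simp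
      | cons q l ih =>
        simp only [List.map_cons, List.sum_cons]
        exact ⟨(hint _ _ _ _).add ih.1, by rw [integral_add (hint _ _ _ _) ih.1, hmono, ih.2]⟩
    refine ⟨?_, ?_, ?_, ?_, ?_⟩
    · have := (hsum [(g a ^ 2, 0, 0, 2), (2 * g a, 1, 0, 1), (1, 2, 0, 0)]).2
      simp [m1, m2, ih1] at this
      rw [← this]
      congr with x
      rw [show ∑ i ∈ s, g i * x i = A x from rfl]
      ring
    · have := (hsum [(1, 0, 0, 2), (1, 0, 1, 0)]).2
      simp [m2, ih2] at this
      rw [this]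
      ring
    · have := (hsum [(1, 0, 0, 4), (2, 0, 1, 2), (1, 0, 2, 0)]).2
      simp [m2, m4, ih2, ih3] at this
      calc _ = _ := by congr with x; ring
        _ = _ := this
        _ = _ := by ring
    · have := (hsum [(1, 0, 0, 6), (3, 0, 1, 4), (3, 0, 2, 2), (1, 0, 3, 0)]).2
      simp [m2, m4, m6, ih2, ih3, ih4] at this
      calc _ = _ := by congr with x; ring
        _ = _ := this
        _ = _ := by ring
    · have := (hsum [(1, 2, 1, 0), (1, 2, 0, 2), (2 * g a, 1, 1, 1), (2 * g a, 1, 0, 3),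
        (g a ^ 2, 0, 1, 2), (g a ^ 2, 0, 0, 4)]).2
      simp [m1, m2, m3, m4, ih1, ih2, ih5] at this
      calc _ = _ := by congr with x; ring
        _ = _ := this
        _ = _ := by ring

theorem stdGaussian_sq_inner_mul_sq_norm (g : EuclideanSpace ℝ (Fin n)) :
    Integrable (fun v => ⟪g, v⟫ ^ 2 * ‖v‖ ^ 2) (stdGaussian (EuclideanSpace ℝ (Fin n))) ∧
    ∫ v, ⟪g, v⟫ ^ 2 * ‖v‖ ^ 2 ∂stdGaussian (EuclideanSpace ℝ (Fin n)) =
      ((n : ℝ) + 2) * ‖g‖ ^ 2 := by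
  have hm : AEMeasurable (WithLp.toLp 2)
    (Measure.pi fun _ : Fin n => gaussianReal 0 1) := by fun_prop
  have hc : Continuous fun v : EuclideanSpace ℝ (Fin n) => ⟪g, v⟫ ^ 2 * ‖v‖ ^ 2 := by fun_prop
  have h := hasAllMoments_eval_pi_gaussianReal (n := n)
  rw [← map_pi_eq_stdGaussian, integrable_map_measure hc.aestronglyMeasurable hm,
    integral_map hm hc.aestronglyMeasurable]
  simp only [Function.comp_def, EuclideanSpace.real_norm_sq_eq, PiLp.inner_apply,
    RCLike.inner_apply, conj_trivial, mul_comm _ (g _)]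
  refine ⟨(((HasAllMoments.sum univ fun i => (HasAllMoments.const (g i)).mul (h i)).pow 2).mul
    (HasAllMoments.sum univ fun i => (h i).pow 2)).integrable, ?_⟩
  simpa using (pi_gaussian_moments (fun i => g i) univ).2.2.2.2

theorem stdGaussian_norm_pow_six :
    Integrable (fun v => ‖v‖ ^ 6) (stdGaussian (EuclideanSpace ℝ (Fin n))) ∧
    ∫ v, ‖v‖ ^ 6 ∂stdGaussian (EuclideanSpace ℝ (Fin n)) =
      (n : ℝ) * (n + 2) * (n + 4) := by
  have hm : AEMeasurable (WithLp.toLp 2)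
    (Measure.pi fun _ : Fin n => gaussianReal 0 1) := by fun_prop
  have hc : Continuous fun v : EuclideanSpace ℝ (Fin n) => (‖v‖ ^ 2) ^ 3 := by fun_prop
  have h := hasAllMoments_eval_pi_gaussianReal (n := n)
  simp only [show ∀ r : ℝ, r ^ 6 = (r ^ 2) ^ 3 by intro r; ring]
  rw [← map_pi_eq_stdGaussian, integrable_map_measure hc.aestronglyMeasurable hm,
    integral_map hm hc.aestronglyMeasurable]
  simp only [Function.comp_def, EuclideanSpace.real_norm_sq_eq]
  refine ⟨((HasAllMoments.sum univ fun i => (h i).pow 2).pow 3).integrable, ?_⟩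
  simpa using (pi_gaussian_moments (fun i => 0) univ).2.2.2.1

theorem abs_sub_sub_inner_gradient_le {f : EuclideanSpace ℝ (Fin n) → ℝ} {M L : ℝ}
    (hf : ∀ x y, |f x - f y| ≤ M * ‖x - y‖)
    (hg : ∀ x y, ‖gradient f x - gradient f y‖ ≤ L * ‖x - y‖) (x v : EuclideanSpace ℝ (Fin n)) :
    |f (x + v) - f x - ⟪gradient f x, v⟫| ≤ L / 2 * ‖v‖ ^ 2 := by
  have hfl : LipschitzWith M.toNNReal f := LipschitzWith.of_dist_le' fun x y => by
    simpa [dist_eq_norm] using hf x y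
  have hgc : Continuous (gradient f) := (LipschitzWith.of_dist_le' (K := L) fun x y => by
    simpa [dist_eq_norm] using hg x y).continuous
  have hae : ∀ᵐ x : EuclideanSpace ℝ (Fin n), ∀ᵐ t : ℝ, DifferentiableAt ℝ f (x + t • v) := by
    rw [Measure.ae_ae_comm]
    · refine .of_forall fun t => ?_
      exact (measurePreserving_add_right volume (t • v)).quasiMeasurePreserving.ae
        hfl.ae_differentiableAt
    · exact (measurableSet_of_differentiableAt ℝ f).preimage
        (f := fun p : EuclideanSpace ℝ (Fin n) × ℝ => p.1 + p.2 • v) (by fun_prop)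
  have hcl : IsClosed {x | |f (x + v) - f x - ⟪gradient f x, v⟫| ≤ L / 2 * ‖v‖ ^ 2} := by
    have := hfl.continuous
    exact isClosed_le (by fun_prop) (by fun_prop)
  refine hcl.closure_subset_iff.2 ?_ ((Measure.dense_of_ae hae) x)
  intro x hx
  have hh : LipschitzWith (M.toNNReal * ‖v‖₊) fun t : ℝ => f (x + t • v) :=
    hfl.comp (LipschitzWith.of_dist_le_mul fun s t => by
      rw [dist_add_left, dist_eq_norm, ← sub_smul, norm_smul, mul_comm, dist_eq_norm]; rfl)
  have hac := (hh.lipschitzOnWith (s := Set.uIcc 0 1)).absolutelyContinuousOnInterval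
  have hint := hac.intervalIntegrable_deriv
  have hftc := hac.integral_deriv_eq_sub
  simp only [one_smul, zero_smul, add_zero] at hftc
  have heq : f (x + v) - f x - ⟪gradient f x, v⟫ =
      ∫ t in (0:ℝ)..1, (deriv (fun t : ℝ => f (x + t • v)) t - ⟪gradient f x, v⟫) := by
    rw [intervalIntegral.integral_sub hint (by simp), hftc]
    simp
  have hbd : ∫ t in (0:ℝ)..1, L * ‖v‖ ^ 2 * t = L / 2 * ‖v‖ ^ 2 := by
    rw [intervalIntegral.integral_const_mul, integral_id]
    ring
  rw [Set.mem_ofPred_eq, heq, ← hbd, ← Real.norm_eq_abs]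
  refine intervalIntegral.norm_integral_le_of_norm_le zero_le_one ?_
    (Continuous.intervalIntegrable (by fun_prop) _ _)
  filter_upwards [hx] with t ht ht01
  have h1 : HasDerivAt (fun t : ℝ => x + t • v) v t := by
    simpa using ((hasDerivAt_id t).smul_const v).const_add x
  have h2 : HasDerivAt (fun t : ℝ => f (x + t • v)) _ t :=
    ht.hasGradientAt.hasFDerivAt.comp_hasDerivAt t h1
  rw [h2.deriv, InnerProductSpace.toDual_apply_apply, ← inner_sub_left]
  calc _ ≤ ‖gradient f (x + t • v) - gradient f x‖ * ‖v‖ := norm_inner_le_norm _ _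
    _ ≤ L * ‖x + t • v - x‖ * ‖v‖ := by gcongr; exact hg _ _
    _ = _ := by
      rw [add_sub_cancel_left, norm_smul, Real.norm_of_nonneg ht01.1.le]
      ring

theorem norm_gradient_le {f : EuclideanSpace ℝ (Fin n) → ℝ} {M : ℝ} (hM : 0 ≤ M)
    (hf : ∀ x y, |f x - f y| ≤ M * ‖x - y‖) (x : EuclideanSpace ℝ (Fin n)) :
    ‖gradient f x‖ ≤ M := by
  rw [gradient, LinearIsometryEquiv.norm_map]
  have := norm_fderiv_le_of_lipschitz ℝ (f := f) (x₀ := x)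
    (LipschitzWith.of_dist_le' (K := M) fun x y => by
      simpa [dist_eq_norm] using hf x y)
  rwa [Real.coe_toNNReal _ hM] at this

theorem sq_norm_estimator_le {f : EuclideanSpace ℝ (Fin n) → ℝ} {M L ν : ℝ} (hν : 0 < ν)
    (hf : ∀ x y, |f x - f y| ≤ M * ‖x - y‖)
    (hg : ∀ x y, ‖gradient f x - gradient f y‖ ≤ L * ‖x - y‖) (x v : EuclideanSpace ℝ (Fin n)) :
    ‖((f (x + ν • v) - f x) / ν) • v‖ ^ 2 ≤
      2 * (⟪gradient f x, v⟫ ^ 2 * ‖v‖ ^ 2) + ν ^ 2 / 2 * L ^ 2 * ‖v‖ ^ 6 := by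
  have h := abs_sub_sub_inner_gradient_le hf hg x (ν • v)
  rw [inner_smul_right, norm_smul, Real.norm_of_nonneg hν.le] at h
  set d := f (x + ν • v) - f x
  set c := ⟪gradient f x, v⟫
  have h' : |d / ν - c| ≤ L * ν / 2 * ‖v‖ ^ 2 := by
    rw [show d / ν - c = (d - ν * c) / ν by field_simp, abs_div, abs_of_pos hν, div_le_iff₀ hν]
    linarith
  have h2 := sq_le_sq' (by linarith [abs_le.1 h']) (abs_le.1 h').2
  rw [norm_smul, mul_pow, Real.norm_eq_abs, sq_abs]
  calc (d / ν) ^ 2 * ‖v‖ ^ 2 ≤ (2 * c ^ 2 + 2 * (d / ν - c) ^ 2) * ‖v‖ ^ 2 := by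
        gcongr
        nlinarith [sq_nonneg (d / ν - 2 * c)]
    _ ≤ (2 * c ^ 2 + 2 * (L * ν / 2 * ‖v‖ ^ 2) ^ 2) * ‖v‖ ^ 2 := by gcongr
    _ = _ := by ring

theorem lintegral_stdGaussian_estimator_le {f : EuclideanSpace ℝ (Fin n) → ℝ} {M L ν : ℝ}
    (hν : 0 < ν) (hM : 0 ≤ M) (hf : ∀ x y, |f x - f y| ≤ M * ‖x - y‖)
    (hg : ∀ x y, ‖gradient f x - gradient f y‖ ≤ L * ‖x - y‖) (x : EuclideanSpace ℝ (Fin n)) :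
    ∫⁻ v, ENNReal.ofReal (‖((f (x + ν • v) - f x) / ν) • v‖ ^ 2)
        ∂stdGaussian (EuclideanSpace ℝ (Fin n)) ≤
      ENNReal.ofReal (2 * (((n : ℝ) + 2) * M ^ 2) +
        ν ^ 2 / 2 * L ^ 2 * (n * (n + 2) * (n + 4))) := by
  obtain ⟨hi1, he1⟩ := stdGaussian_sq_inner_mul_sq_norm (gradient f x)
  obtain ⟨hi2, he2⟩ := stdGaussian_norm_pow_six (n := n)
  refine (lintegral_mono fun v =>
    ENNReal.ofReal_le_ofReal (sq_norm_estimator_le hν hf hg x v)).trans ?_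
  rw [← ofReal_integral_eq_lintegral_ofReal ((hi1.const_mul 2).fun_add (hi2.const_mul _))
    (.of_forall fun v => by positivity), integral_add (hi1.const_mul 2) (hi2.const_mul _),
    integral_const_mul, integral_const_mul, he1, he2]
  gcongr
  exact norm_gradient_le hM hf x

end

/-- second-moment bound for the zeroth-order gradient estimator
`G_ν(x, ξ, u) = ((F(x+νu, ξ) − F(x, ξ))/ν) u`:
`E‖G_ν(x,ξ,u)‖² ≤ (ν²/2) L² (n+6)³ + 4 (n+4)(σ² + B̃²)`,
where `B̃ = (ν/2) L (n+3)^{3/2} + L D_X + M`. -/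
theorem statement4
    {n : ℕ} (hn : 1 ≤ n)
    {Ω : Type*} [MeasurableSpace Ω] (P : Measure Ω) [IsProbabilityMeasure P]
    {𝓧 : Type*} [MeasurableSpace 𝓧]
    (ν D_X M L σ : ℝ) (hν : 0 < ν) (hD : 0 ≤ D_X)
    (u : Ω → EuclideanSpace ℝ (Fin n))
    (hu : IsStdGaussian P u) (humeas : Measurable u)
    (ξ : Ω → 𝓧) (hξmeas : Measurable ξ)
    (hindep : IndepFun u ξ P)
    (F : EuclideanSpace ℝ (Fin n) → 𝓧 → ℝ)
    (hFmeas : Measurable (Function.uncurry F))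
    (f : EuclideanSpace ℝ (Fin n) → ℝ)
    (hlip : ∀ᵐ ω ∂P, ∀ x y, |F x (ξ ω) - F y (ξ ω)| ≤ M * ‖x - y‖)
    (hgradlip : ∀ᵐ ω ∂P, ∀ x y,
      ‖gradient (fun z => F z (ξ ω)) x - gradient (fun z => F z (ξ ω)) y‖ ≤ L * ‖x - y‖)
    (hgradunbiased : ∀ x, ∫ ω, gradient (fun z => F z (ξ ω)) x ∂P = gradient f x)
    (hgradvar : ∀ x, ∫ ω, ‖gradient (fun z => F z (ξ ω)) x - gradient f x‖ ^ 2 ∂P ≤ σ ^ 2)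
    (G : EuclideanSpace ℝ (Fin n) → Ω → EuclideanSpace ℝ (Fin n))
    (hG : ∀ x ω, G x ω = ((F (x + ν • u ω) (ξ ω) - F x (ξ ω)) / ν) • u ω)
    (B : ℝ) (hB : B = ν / 2 * L * ((n : ℝ) + 3) ^ ((3 : ℝ) / 2) + L * D_X + M) :
    ∀ x, ∫ ω, ‖G x ω‖ ^ 2 ∂P
      ≤ ν ^ 2 / 2 * L ^ 2 * ((n : ℝ) + 6) ^ 3 + 4 * ((n : ℝ) + 4) * (σ ^ 2 + B ^ 2) := by
  have hnonneg {K : ℝ} {p : EuclideanSpace ℝ (Fin n) → EuclideanSpace ℝ (Fin n) → ℝ}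
      (hp : ∀ x y, 0 ≤ p x y) (h : ∀ x y, p x y ≤ K * ‖x - y‖) : 0 ≤ K := by
    have := (hp _ _).trans (h (EuclideanSpace.single ⟨0, hn⟩ 1) 0)
    simpa using this
  have hM : 0 ≤ M := by
    obtain ⟨ω, hω⟩ := hlip.exists
    exact hnonneg (fun _ _ => abs_nonneg _) hω
  have hL : 0 ≤ L := by
    obtain ⟨ω, hω⟩ := hgradlip.exists
    exact hnonneg (fun _ _ => norm_nonneg _) hω
  have hMB : M ≤ B := by
    rw [hB]
    have : 0 ≤ ν / 2 * L * ((n : ℝ) + 3) ^ ((3 : ℝ) / 2) + L * D_X := by positivity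
    linarith
  have hlaw : P.map u = stdGaussian (EuclideanSpace ℝ (Fin n)) := by
    rw [← map_pi_eq_stdGaussian, ← hu, Measure.map_map (by fun_prop) (by fun_prop)]
    rfl
  intro x
  set Φ : EuclideanSpace ℝ (Fin n) × 𝓧 → ENNReal := fun p =>
    ENNReal.ofReal (‖((F (x + ν • p.1) p.2 - F x p.2) / ν) • p.1‖ ^ 2) with hΦ
  have hΦm : Measurable Φ := by
    have h1 : Measurable fun p : EuclideanSpace ℝ (Fin n) × 𝓧 => F (x + ν • p.1) p.2 :=
      hFmeas.comp (f := fun p : EuclideanSpace ℝ (Fin n) × 𝓧 => (x + ν • p.1, p.2)) (by fun_prop)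
    have h2 : Measurable fun p : EuclideanSpace ℝ (Fin n) × 𝓧 => F x p.2 :=
      hFmeas.comp (f := fun p : EuclideanSpace ℝ (Fin n) × 𝓧 => (x, p.2)) (by fun_prop)
    fun_prop
  have hbound : ∫⁻ ω, ENNReal.ofReal (‖G x ω‖ ^ 2) ∂P ≤
      ENNReal.ofReal (2 * (((n : ℝ) + 2) * M ^ 2) +
        ν ^ 2 / 2 * L ^ 2 * (n * (n + 2) * (n + 4))) := by
    calc ∫⁻ ω, ENNReal.ofReal (‖G x ω‖ ^ 2) ∂P
        = ∫⁻ ω, Φ (u ω, ξ ω) ∂P := by simp only [hG, hΦ]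
      _ = ∫⁻ p, Φ p ∂(stdGaussian (EuclideanSpace ℝ (Fin n))).prod (P.map ξ) := by
        rw [← hlaw, ← (indepFun_iff_map_prod_eq_prod_map_map humeas.aemeasurable
          hξmeas.aemeasurable).1 hindep, lintegral_map hΦm (by fun_prop)]
      _ = ∫⁻ ω, ∫⁻ v, Φ (v, ξ ω) ∂stdGaussian (EuclideanSpace ℝ (Fin n)) ∂P := by
        have : IsProbabilityMeasure (P.map ξ) := Measure.isProbabilityMeasure_map (by fun_prop)
        rw [lintegral_prod_symm' _ hΦm, lintegral_map hΦm.lintegral_prod_left' hξmeas]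
      _ ≤ ∫⁻ _, ENNReal.ofReal (2 * (((n : ℝ) + 2) * M ^ 2) +
          ν ^ 2 / 2 * L ^ 2 * (n * (n + 2) * (n + 4))) ∂P := by
        refine lintegral_mono_ae ?_
        filter_upwards [hlip, hgradlip] with ω h1 h2
        exact lintegral_stdGaussian_estimator_le hν hM h1 h2 x
      _ = _ := by simp
  have hGm : Measurable fun ω => ‖G x ω‖ ^ 2 := by
    have h1 : Measurable fun ω => F (x + ν • u ω) (ξ ω) :=
      hFmeas.comp (f := fun ω => (x + ν • u ω, ξ ω)) (by fun_prop)
    have h2 : Measurable fun ω => F x (ξ ω) := hFmeas.comp (f := fun ω => (x, ξ ω)) (by fun_prop)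
    simp only [hG]
    fun_prop
  rw [integral_eq_lintegral_of_nonneg_ae (.of_forall fun ω => by positivity)
    hGm.aestronglyMeasurable]
  refine (ENNReal.toReal_le_of_le_ofReal (by positivity) hbound).trans ?_
  have e1 : 2 * (((n : ℝ) + 2) * M ^ 2) ≤ 4 * ((n : ℝ) + 4) * (σ ^ 2 + B ^ 2) := by
    have hB2 : M ^ 2 ≤ σ ^ 2 + B ^ 2 := by nlinarith [sq_nonneg σ]
    calc 2 * (((n : ℝ) + 2) * M ^ 2) ≤ 4 * ((n : ℝ) + 4) * M ^ 2 := by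
          nlinarith [mul_nonneg (Nat.cast_nonneg (α := ℝ) n) (sq_nonneg M), sq_nonneg M]
      _ ≤ _ := by gcongr
  have e2 : ν ^ 2 / 2 * L ^ 2 * ((n : ℝ) * (n + 2) * (n + 4)) ≤
      ν ^ 2 / 2 * L ^ 2 * ((n : ℝ) + 6) ^ 3 := by
    gcongr
    rw [pow_three']
    gcongr <;> linarith
  linarith
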